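/- Let X_1, …, X_m be independent random variables, each geometrically distributed with P(X_j = t) = 1/2^{t+1}, and let k ∈ ℕ. The expected number of indices j such that X_j < k and X_j ≥ X_z for all z with j ≤ z ≤ m is at most k. -/

import Mathlib

open scoped ENNReal

open Classical in
/-- The number of indices `j` with `X j = t` such that no later entry exceeds `t`. -/
noncomputable def suffixMaxCount (t : ℕ) {m : ℕ} (X : Fin m → ℕ) : ℝ≥0∞ :=
  ∑ j : Fin m, if X j = t ∧ ∀ z : Fin m, j ≤ z → X z ≤ t then 1 else 0

open Classical in
/-- The indicator of the event that all entries of `X` are at most `t`. -/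
noncomputable def allLeIndicator (t : ℕ) {m : ℕ} (X : Fin m → ℕ) : ℝ≥0∞ :=
  if ∀ z : Fin m, X z ≤ t then 1 else 0

theorem suffixMaxCount_cons (t a : ℕ) {m : ℕ} (Y : Fin m → ℕ) :
    suffixMaxCount t (Fin.cons a Y : Fin (m + 1) → ℕ) =
      (if a = t then 1 else 0) * allLeIndicator t Y + suffixMaxCount t Y := by
  classical
  unfold suffixMaxCount allLeIndicator
  rw [Fin.sum_univ_succ]
  congr 1
  · by_cases h : a = t
    · subst h
      simp [Fin.forall_fin_succ]
    · simp [h]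
  · simp [Fin.forall_fin_succ]

theorem allLeIndicator_cons (t a : ℕ) {m : ℕ} (Y : Fin m → ℕ) :
    allLeIndicator t (Fin.cons a Y : Fin (m + 1) → ℕ) =
      (if a ≤ t then 1 else 0) * allLeIndicator t Y := by
  classical
  unfold allLeIndicator
  by_cases h : a ≤ t <;> simp [Fin.forall_fin_succ, h]

theorem tsum_half_pow_succ : ∑' a : ℕ, (1 / 2 : ℝ≥0∞) ^ (a + 1) = 1 := by
  rw [ENNReal.tsum_geometric_add_one, one_div, ENNReal.one_sub_inv_two, inv_inv]
  exact ENNReal.inv_mul_cancel two_ne_zero ENNReal.ofNat_ne_top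

theorem tsum_half_pow_succ_mul_indicators (t : ℕ) :
    ∑' a : ℕ, (1 / 2 : ℝ≥0∞) ^ (a + 1) *
      ((if a = t then 1 else 0) + (if a ≤ t then 1 else 0)) = 1 := by
  have hle : ∑' a : ℕ, (1 / 2 : ℝ≥0∞) ^ (a + 1) * (if a ≤ t then 1 else 0) =
      ∑ a ∈ Finset.range (t + 1), (1 / 2 : ℝ≥0∞) ^ (a + 1) := by
    rw [tsum_eq_sum (s := Finset.range (t + 1))]
    · refine Finset.sum_congr rfl fun a ha => ?_
      rw [Finset.mem_range, Nat.lt_succ_iff] at ha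
      simp [ha]
    · intro a ha
      rw [Finset.mem_range, Nat.lt_succ_iff] at ha
      simp [ha]
  have hsum : ∀ n : ℕ, (1 / 2 : ℝ≥0∞) ^ n +
      ∑ a ∈ Finset.range n, (1 / 2 : ℝ≥0∞) ^ (a + 1) = 1 := by
    intro n
    induction n with
    | zero => simp
    | succ n ih =>
      rw [Finset.sum_range_succ, add_comm (Finset.sum _ _), ← add_assoc, pow_succ, ← mul_add,
        ENNReal.add_halves, mul_one, ih]
  simp_rw [mul_add]
  rw [ENNReal.tsum_add, hle, tsum_eq_single t (by intro b hb; simp [hb])]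
  simpa using hsum (t + 1)

theorem tsum_pi_fin_succ {m : ℕ} (f : (Fin (m + 1) → ℕ) → ℝ≥0∞) :
    ∑' X, f X = ∑' Y : Fin m → ℕ, ∑' a : ℕ, f (Fin.cons a Y : Fin (m + 1) → ℕ) := by
  rw [← (Fin.consEquiv fun _ : Fin (m + 1) => ℕ).tsum_eq]
  exact (ENNReal.tsum_prod
    (f := fun a Y => f (Fin.cons a Y : Fin (m + 1) → ℕ))).trans ENNReal.tsum_comm

theorem tsum_suffixMaxCount_add_allLeIndicator (t m : ℕ) :
    ∑' X : Fin m → ℕ, (∏ j : Fin m, (1 / 2 : ℝ≥0∞) ^ (X j + 1)) *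
      (suffixMaxCount t X + allLeIndicator t X) = 1 := by
  induction m with
  | zero =>
    rw [tsum_eq_single default (fun b hb => absurd (Subsingleton.elim _ _) hb)]
    simp [suffixMaxCount, allLeIndicator]
  | succ m ih =>
    rw [tsum_pi_fin_succ]
    refine Eq.trans (tsum_congr fun Y => ?_) ih
    have hterm : ∀ a : ℕ, (∏ j : Fin (m + 1),
          (1 / 2 : ℝ≥0∞) ^ ((Fin.cons a Y : Fin (m + 1) → ℕ) j + 1)) *
        (suffixMaxCount t (Fin.cons a Y : Fin (m + 1) → ℕ) +
          allLeIndicator t (Fin.cons a Y : Fin (m + 1) → ℕ)) =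
        ((1 / 2 : ℝ≥0∞) ^ (a + 1) * ((if a = t then 1 else 0) + (if a ≤ t then 1 else 0))) *
            ((∏ j : Fin m, (1 / 2 : ℝ≥0∞) ^ (Y j + 1)) * allLeIndicator t Y) +
          (1 / 2 : ℝ≥0∞) ^ (a + 1) *
            ((∏ j : Fin m, (1 / 2 : ℝ≥0∞) ^ (Y j + 1)) * suffixMaxCount t Y) := by
      intro a
      rw [suffixMaxCount_cons, allLeIndicator_cons, Fin.prod_univ_succ]
      simp only [Fin.cons_zero, Fin.cons_succ]
      ring
    rw [tsum_congr hterm, ENNReal.tsum_add, ENNReal.tsum_mul_right, ENNReal.tsum_mul_right,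
      tsum_half_pow_succ_mul_indicators, tsum_half_pow_succ]
    ring

theorem card_suffixMax_lt_eq_sum (m k : ℕ) (X : Fin m → ℕ) :
    ((Nat.card {j : Fin m // X j < k ∧ ∀ z : Fin m, j ≤ z → X z ≤ X j} : ℕ) : ℝ≥0∞) =
      ∑ t ∈ Finset.range k, suffixMaxCount t X := by
  classical
  unfold suffixMaxCount
  rw [Finset.sum_comm, Nat.card_eq_fintype_card, Fintype.card_subtype, Finset.card_filter,
    Nat.cast_sum]
  refine Finset.sum_congr rfl fun j _ => ?_
  simp_rw [ite_and]
  rw [Finset.sum_ite_eq]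
  simp

/-- **Expected length of the zipped path `P`.** Let `X_1, …, X_m` be independent
geometric random variables with `P(X_j = t) = 1/2^(t+1)` (modelled by the product
PMF `μ` on `Fin m → ℕ`), and let `k ∈ ℕ`. The expected number of indices `j` such
that `X j < k` and `X j ≥ X z` for all `z` with `j ≤ z ≤ m` is at most `k`. -/
theorem expected_P_path_length (m k : ℕ)
    (μ : PMF (Fin m → ℕ))
    (hμ : ∀ X : Fin m → ℕ, μ X = ∏ j : Fin m, (1 / 2 : ℝ≥0∞) ^ (X j + 1)) :
    ∑' X : Fin m → ℕ,
        μ X * ((Nat.card {j : Fin m // X j < k ∧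
            ∀ z : Fin m, j ≤ z → X z ≤ X j} : ℕ) : ℝ≥0∞) ≤ (k : ℝ≥0∞) := by
  simp_rw [hμ, card_suffixMax_lt_eq_sum, Finset.mul_sum]
  rw [Summable.tsum_finsetSum fun _ _ => ENNReal.summable]
  calc
    _ ≤ ∑ _t ∈ Finset.range k, (1 : ℝ≥0∞) := by
      refine Finset.sum_le_sum fun t _ => ?_
      refine le_of_le_of_eq ?_ (tsum_suffixMaxCount_add_allLeIndicator t m)
      exact ENNReal.tsum_le_tsum fun X => mul_le_mul' le_rfl le_self_add
    _ = k := by simp
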